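/- Let 1 ≤ p < ∞ and t ∈ [0,1). For the operator S_t = S ∘ C_t on H^p, the point spectrum is empty, the residual spectrum equals {0}, and the continuous spectrum is empty; in particular, the spectrum of S_t on H^p is exactly {0}. -/

import Mathlib

open Complex MeasureTheory Metric Set Filter Topology

/-- The generalized Cesàro operator `C_t`, given by
`(C_t f)(z) = ∫_0^1 f(sz)/(1 - s t z) ds`, which equals `f(0)` at `z = 0` and
`(1/z)∫_0^z f(ξ)/(1 - tξ) dξ` for `z ≠ 0`. -/
noncomputable def cesaro (t : ℝ) (f : ℂ → ℂ) (z : ℂ) : ℂ :=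
  ∫ s in (0:ℝ)..1, f ((s : ℂ) * z) / (1 - (s : ℂ) * (t : ℂ) * z)

/-- The integral means `M_p(r, f)`. -/
noncomputable def Mp (p : ℝ) (r : ℝ) (f : ℂ → ℂ) : ℝ :=
  ((1 / (2 * Real.pi)) *
    ∫ θ in (0:ℝ)..(2 * Real.pi), ‖f ((r : ℂ) * Complex.exp ((θ : ℂ) * Complex.I))‖ ^ p) ^ (1 / p)

/-- The Hardy space norm `‖f‖_p = sup_{0 ≤ r < 1} M_p(r, f)`. -/
noncomputable def hardyNorm (p : ℝ) (f : ℂ → ℂ) : ℝ :=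
  sSup ((fun r => Mp p r f) '' Set.Ico (0:ℝ) 1)

/-- Membership in the Hardy space `H^p`: holomorphic on the unit disc with bounded
integral means. -/
def MemHp (p : ℝ) (f : ℂ → ℂ) : Prop :=
  DifferentiableOn ℂ f (Metric.ball (0:ℂ) 1) ∧
    BddAbove ((fun r => Mp p r f) '' Set.Ico (0:ℝ) 1)

/-- `λ` is in the resolvent set of the operator `T` acting on the space
`X = {f : Mem f}` with norm `N`: the operator `λI - T` maps `X` into `X`, is
surjective onto `X` (modulo equality on the disc) and has a continuous (linear)
inverse, i.e. it is bounded below. -/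
def IsResolventPt (Mem : (ℂ → ℂ) → Prop) (N : (ℂ → ℂ) → ℝ)
    (T : (ℂ → ℂ) → ℂ → ℂ) (lam : ℂ) : Prop :=
  (∀ f, Mem f → Mem (fun z => lam * f z - T f z)) ∧
  (∀ g, Mem g → ∃ f, Mem f ∧ Set.EqOn (fun z => lam * f z - T f z) g (Metric.ball (0:ℂ) 1)) ∧
  (∃ C : ℝ, ∀ f, Mem f → N f ≤ C * N (fun z => lam * f z - T f z))

/-- The operator `S_t = S ∘ C_t`, `(S_t f)(z) = ∫_0^z f(ξ)/(1-tξ) dξ = z (C_t f)(z)`. -/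
noncomputable def Stop (t : ℝ) (f : ℂ → ℂ) (z : ℂ) : ℂ := z * cesaro t f z

/-- `λI - S_t` is injective on `H^p`. -/
def StInjAt (p t : ℝ) (lam : ℂ) : Prop :=
  ∀ f, MemHp p f →
    Set.EqOn (fun z => lam * f z - Stop t f z) 0 (Metric.ball (0:ℂ) 1) →
    Set.EqOn f 0 (Metric.ball (0:ℂ) 1)

/-- `λI - S_t` has dense range in `H^p`. -/
def StDenseRanAt (p t : ℝ) (lam : ℂ) : Prop :=
  ∀ g, MemHp p g → ∀ ε > (0:ℝ), ∃ f, MemHp p f ∧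
    hardyNorm p (fun z => (lam * f z - Stop t f z) - g z) < ε

/-- `λI - S_t` is surjective on `H^p`. -/
def StSurjAt (p t : ℝ) (lam : ℂ) : Prop :=
  ∀ g, MemHp p g → ∃ f, MemHp p f ∧
    Set.EqOn (fun z => lam * f z - Stop t f z) g (Metric.ball (0:ℂ) 1)

theorem one_sub_le_norm_one_sub_mul {t : ℝ} (ht0 : 0 ≤ t) {z : ℂ} (hz : z ∈ ball (0 : ℂ) 1) :
    1 - t ≤ ‖1 - (t : ℂ) * z‖ := by
  rw [mem_ball_zero_iff] at hz
  have h := norm_sub_norm_le (1 : ℂ) ((t : ℂ) * z)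
  rw [norm_one, norm_mul, Complex.norm_of_nonneg ht0] at h
  nlinarith

theorem ofReal_mul_mem_ball {s : ℝ} (hs : s ∈ Icc (0 : ℝ) 1) {z : ℂ} (hz : z ∈ ball (0 : ℂ) 1) :
    (s : ℂ) * z ∈ ball (0 : ℂ) 1 := by
  rw [mem_ball_zero_iff] at hz ⊢
  rw [norm_mul, Complex.norm_of_nonneg hs.1]
  nlinarith [hs.2, norm_nonneg z]

theorem one_sub_mul_ne_zero {t : ℝ} (ht0 : 0 ≤ t) (ht1 : t < 1) {z : ℂ}
    (hz : z ∈ ball (0 : ℂ) 1) : 1 - (t : ℂ) * z ≠ 0 := by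
  have h := one_sub_le_norm_one_sub_mul ht0 hz
  exact norm_pos_iff.mp (by linarith)

theorem continuousOn_comp_ofReal_mul {q : ℂ → ℂ} (hq : ContinuousOn q (ball (0 : ℂ) 1)) {z : ℂ}
    (hz : z ∈ ball (0 : ℂ) 1) : ContinuousOn (fun s : ℝ => q ((s : ℂ) * z)) (Icc (0 : ℝ) 1) :=
  hq.comp (by fun_prop) fun _ hs => ofReal_mul_mem_ball hs hz

theorem Stop_zero (t : ℝ) (f : ℂ → ℂ) : Stop t f 0 = 0 := by simp [Stop]

theorem hasDerivAt_Stop {t : ℝ} (ht0 : 0 ≤ t) (ht1 : t < 1) {f : ℂ → ℂ}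
    (hf : DifferentiableOn ℂ f (ball (0 : ℂ) 1)) {z : ℂ} (hz : z ∈ ball (0 : ℂ) 1) :
    HasDerivAt (Stop t f) (f z / (1 - t * z)) z := by
  have hq : DifferentiableOn ℂ (fun z => f z / (1 - t * z)) (ball (0 : ℂ) 1) :=
    hf.div (by fun_prop) fun z hz => one_sub_mul_ne_zero ht0 ht1 hz
  obtain ⟨G, hG0, hG⟩ := hq.isExactOn_ball.with_val_at 0 0
  refine (hG z hz).congr_of_eventuallyEq ?_
  filter_upwards [isOpen_ball.mem_nhds hz] with w hw
  have h := intervalIntegral.integral_unitInterval_deriv_eq_sub (f := G)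
    (f' := fun z => f z / (1 - t * z)) (z₀ := 0) (z₁ := w)
    (by simpa using continuousOn_comp_ofReal_mul hq.continuousOn hw)
    (fun s hs => by
      have := hG _ (ofReal_mul_mem_ball hs hw)
      simpa using this)
  simp only [zero_add, hG0, sub_zero, smul_eq_mul, real_smul] at h
  rw [← h, Stop, cesaro]
  congr 1
  refine intervalIntegral.integral_congr fun s _ => ?_
  ring_nf

theorem differentiableOn_Stop {t : ℝ} (ht0 : 0 ≤ t) (ht1 : t < 1) {f : ℂ → ℂ}
    (hf : DifferentiableOn ℂ f (ball (0 : ℂ) 1)) :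
    DifferentiableOn ℂ (Stop t f) (ball (0 : ℂ) 1) := fun _ hz =>
  (hasDerivAt_Stop ht0 ht1 hf hz).differentiableAt.differentiableWithinAt

theorem norm_Stop_le {t : ℝ} (ht0 : 0 ≤ t) (ht1 : t < 1) {f : ℂ → ℂ}
    (hf : DifferentiableOn ℂ f (ball (0 : ℂ) 1)) {z : ℂ} (hz : z ∈ ball (0 : ℂ) 1) :
    ‖Stop t f z‖ ≤ (1 - t)⁻¹ * ∫ s in (0 : ℝ)..1, ‖f ((s : ℂ) * z)‖ := by
  have ht : 0 < 1 - t := by linarith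
  have hz' := mem_ball_zero_iff.mp hz
  have hint : IntervalIntegrable (fun s : ℝ => (1 - t)⁻¹ * ‖f ((s : ℂ) * z)‖) volume 0 1 :=
    ((continuousOn_comp_ofReal_mul hf.continuousOn hz).norm.const_mul _).intervalIntegrable_of_Icc
      zero_le_one
  have h : ‖cesaro t f z‖ ≤ ∫ s in (0 : ℝ)..1, (1 - t)⁻¹ * ‖f ((s : ℂ) * z)‖ := by
    refine intervalIntegral.norm_integral_le_of_norm_le zero_le_one ?_ hint
    refine Eventually.of_forall fun s hs => ?_
    have hs' : s ∈ Icc (0 : ℝ) 1 := ⟨hs.1.le, hs.2⟩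
    have hle := one_sub_le_norm_one_sub_mul ht0 (ofReal_mul_mem_ball hs' hz)
    rw [norm_div, div_eq_inv_mul, show (s : ℂ) * t * z = t * (s * z) by ring]
    gcongr
  rw [intervalIntegral.integral_const_mul] at h
  rw [Stop, norm_mul]
  exact (mul_le_of_le_one_left (norm_nonneg _) hz'.le).trans h

theorem eqOn_ball_of_hasDerivAt {u v u' : ℂ → ℂ}
    (hu : ∀ z ∈ ball (0 : ℂ) 1, HasDerivAt u (u' z) z)
    (hv : ∀ z ∈ ball (0 : ℂ) 1, HasDerivAt v (u' z) z) (h0 : u 0 = v 0) :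
    EqOn u v (ball (0 : ℂ) 1) :=
  isOpen_ball.eqOn_of_deriv_eq (convex_ball _ _).isPreconnected
    (fun z hz => (hu z hz).differentiableAt.differentiableWithinAt)
    (fun z hz => (hv z hz).differentiableAt.differentiableWithinAt)
    (fun z hz => by rw [(hu z hz).deriv, (hv z hz).deriv]) (mem_ball_self one_pos) h0

/-- The integrating factor `exp (λ⁻¹ ∫_0^z dξ / (1 - tξ))` of the equation `λ f - S_t f = g`. -/
noncomputable def stFactor (t : ℝ) (lam z : ℂ) : ℂ := Complex.exp (Stop t (fun _ => 1) z / lam)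

theorem hasDerivAt_stFactor {t : ℝ} (ht0 : 0 ≤ t) (ht1 : t < 1) (lam : ℂ) {z : ℂ}
    (hz : z ∈ ball (0 : ℂ) 1) :
    HasDerivAt (stFactor t lam) (stFactor t lam z * (1 / (1 - t * z) / lam)) z :=
  ((hasDerivAt_Stop ht0 ht1 (differentiableOn_const 1) hz).div_const lam).cexp

theorem stFactor_ne_zero (t : ℝ) (lam z : ℂ) : stFactor t lam z ≠ 0 := Complex.exp_ne_zero _

theorem differentiableOn_div_stFactor {t : ℝ} (ht0 : 0 ≤ t) (ht1 : t < 1) (lam : ℂ) {g : ℂ → ℂ}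
    (hg : DifferentiableOn ℂ g (ball (0 : ℂ) 1)) :
    DifferentiableOn ℂ (fun z => g z / stFactor t lam z) (ball (0 : ℂ) 1) :=
  hg.div (fun _ hz =>
    (hasDerivAt_stFactor ht0 ht1 lam hz).differentiableAt.differentiableWithinAt)
    fun z _ => stFactor_ne_zero t lam z

/-- The exponential bound for the integrating factor and its inverse. -/
noncomputable def stFactorBound (t : ℝ) (lam : ℂ) : ℝ := Real.exp ((1 - t)⁻¹ / ‖lam‖)

theorem norm_Stop_one_div_le {t : ℝ} (ht0 : 0 ≤ t) (ht1 : t < 1) (lam : ℂ) {z : ℂ}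
    (hz : z ∈ ball (0 : ℂ) 1) :
    ‖Stop t (fun _ => 1) z / lam‖ ≤ (1 - t)⁻¹ / ‖lam‖ := by
  have h := norm_Stop_le ht0 ht1 (differentiableOn_const (1 : ℂ)) hz
  rw [norm_div]
  gcongr
  simpa using h

theorem norm_stFactor_le {t : ℝ} (ht0 : 0 ≤ t) (ht1 : t < 1) (lam : ℂ) {z : ℂ}
    (hz : z ∈ ball (0 : ℂ) 1) : ‖stFactor t lam z‖ ≤ stFactorBound t lam :=
  (Complex.norm_exp_le_exp_norm _).trans
    (Real.exp_le_exp.mpr (norm_Stop_one_div_le ht0 ht1 lam hz))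

theorem norm_stFactor_inv_le {t : ℝ} (ht0 : 0 ≤ t) (ht1 : t < 1) (lam : ℂ) {z : ℂ}
    (hz : z ∈ ball (0 : ℂ) 1) : ‖(stFactor t lam z)⁻¹‖ ≤ stFactorBound t lam := by
  rw [stFactor, ← Complex.exp_neg]
  refine (Complex.norm_exp_le_exp_norm _).trans (Real.exp_le_exp.mpr ?_)
  rw [norm_neg]
  exact norm_Stop_one_div_le ht0 ht1 lam hz

/-- The solution of `λ f - S_t f = g` for `λ ≠ 0`. -/
noncomputable def stResolvent (t : ℝ) (lam : ℂ) (g : ℂ → ℂ) (z : ℂ) : ℂ :=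
  (g z + stFactor t lam z * Stop t (fun w => g w / stFactor t lam w) z / lam) / lam

theorem hasDerivAt_stFactor_mul_Stop {t : ℝ} (ht0 : 0 ≤ t) (ht1 : t < 1) {lam : ℂ}
    (hlam : lam ≠ 0) {g : ℂ → ℂ} (hg : DifferentiableOn ℂ g (ball (0 : ℂ) 1)) {z : ℂ}
    (hz : z ∈ ball (0 : ℂ) 1) :
    HasDerivAt (fun z => stFactor t lam z * Stop t (fun w => g w / stFactor t lam w) z / lam)
      (stResolvent t lam g z / (1 - t * z)) z := by
  have h1 := one_sub_mul_ne_zero ht0 ht1 hz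
  have hW := stFactor_ne_zero t lam z
  convert! ((hasDerivAt_stFactor ht0 ht1 lam hz).mul
    (hasDerivAt_Stop ht0 ht1 (differentiableOn_div_stFactor ht0 ht1 lam hg) hz)).div_const lam
    using 1
  rw [stResolvent]
  field_simp
  ring

theorem differentiableOn_stResolvent {t : ℝ} (ht0 : 0 ≤ t) (ht1 : t < 1) {lam : ℂ}
    (hlam : lam ≠ 0) {g : ℂ → ℂ} (hg : DifferentiableOn ℂ g (ball (0 : ℂ) 1)) :
    DifferentiableOn ℂ (stResolvent t lam g) (ball (0 : ℂ) 1) :=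
  (hg.add fun _ hz => (hasDerivAt_stFactor_mul_Stop ht0 ht1 hlam hg
    hz).differentiableAt.differentiableWithinAt).div_const lam

theorem stResolvent_right_inverse {t : ℝ} (ht0 : 0 ≤ t) (ht1 : t < 1) {lam : ℂ}
    (hlam : lam ≠ 0) {g : ℂ → ℂ} (hg : DifferentiableOn ℂ g (ball (0 : ℂ) 1)) :
    EqOn (fun z => lam * stResolvent t lam g z - Stop t (stResolvent t lam g) z) g
      (ball (0 : ℂ) 1) := by
  have h := eqOn_ball_of_hasDerivAt
    (fun z hz => hasDerivAt_Stop ht0 ht1 (differentiableOn_stResolvent ht0 ht1 hlam hg) hz)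
    (fun z hz => hasDerivAt_stFactor_mul_Stop ht0 ht1 hlam hg hz) (by simp [Stop_zero])
  intro z hz
  simp only [h hz]
  rw [stResolvent]
  field_simp
  ring

theorem stResolvent_left_inverse {t : ℝ} (ht0 : 0 ≤ t) (ht1 : t < 1) {lam : ℂ}
    (hlam : lam ≠ 0) {f : ℂ → ℂ} (hf : DifferentiableOn ℂ f (ball (0 : ℂ) 1)) :
    EqOn f (stResolvent t lam (fun z => lam * f z - Stop t f z)) (ball (0 : ℂ) 1) := by
  have hg : DifferentiableOn ℂ (fun z => lam * f z - Stop t f z) (ball (0 : ℂ) 1) :=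
    (hf.const_mul lam).sub (differentiableOn_Stop ht0 ht1 hf)
  have h := eqOn_ball_of_hasDerivAt (u := fun z => Stop t f z / stFactor t lam z)
    (v := fun z => Stop t (fun w => (lam * f w - Stop t f w) / stFactor t lam w) z / lam)
    (u' := fun z => (lam * f z - Stop t f z) / stFactor t lam z / (1 - t * z) / lam)
    (fun z hz => by
      have h1 := one_sub_mul_ne_zero ht0 ht1 hz
      have hW := stFactor_ne_zero t lam z
      convert! (hasDerivAt_Stop ht0 ht1 hf hz).div (hasDerivAt_stFactor ht0 ht1 lam hz) hW using 1
      field_simp)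
    (fun z hz => (hasDerivAt_Stop ht0 ht1
      (differentiableOn_div_stFactor ht0 ht1 lam hg) hz).div_const lam)
    (by simp [Stop_zero])
  intro z hz
  have hW := stFactor_ne_zero t lam z
  have hz' := h hz
  simp only at hz'
  rw [stResolvent, mul_div_assoc, ← hz']
  field_simp
  ring

theorem norm_stResolvent_le {t : ℝ} (ht0 : 0 ≤ t) (ht1 : t < 1) (lam : ℂ)
    {g : ℂ → ℂ} (hg : DifferentiableOn ℂ g (ball (0 : ℂ) 1)) {z : ℂ} (hz : z ∈ ball (0 : ℂ) 1) :
    ‖stResolvent t lam g z‖ ≤ ‖lam‖⁻¹ * ‖g z‖ +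
      (stFactorBound t lam ^ 2 * (1 - t)⁻¹ * ‖lam‖⁻¹ ^ 2) *
        ∫ s in (0 : ℝ)..1, ‖g ((s : ℂ) * z)‖ := by
  have ht : 0 < 1 - t := by linarith
  have hK : 0 < stFactorBound t lam := Real.exp_pos _
  have hd := differentiableOn_div_stFactor ht0 ht1 lam hg
  have hint : ∫ s in (0 : ℝ)..1, ‖g ((s : ℂ) * z) / stFactor t lam ((s : ℂ) * z)‖ ≤
      ∫ s in (0 : ℝ)..1, stFactorBound t lam * ‖g ((s : ℂ) * z)‖ := by
    refine intervalIntegral.integral_mono_on zero_le_one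
      ((continuousOn_comp_ofReal_mul hd.continuousOn hz).norm.intervalIntegrable_of_Icc zero_le_one)
      (((continuousOn_comp_ofReal_mul hg.continuousOn hz).norm.const_mul
        _).intervalIntegrable_of_Icc zero_le_one) fun s hs => ?_
    rw [div_eq_inv_mul, norm_mul]
    gcongr
    exact norm_stFactor_inv_le ht0 ht1 lam (ofReal_mul_mem_ball hs hz)
  rw [intervalIntegral.integral_const_mul] at hint
  have hS : ‖Stop t (fun w => g w / stFactor t lam w) z‖ ≤
      (1 - t)⁻¹ * (stFactorBound t lam * ∫ s in (0 : ℝ)..1, ‖g ((s : ℂ) * z)‖) :=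
    (norm_Stop_le ht0 ht1 hd hz).trans (by gcongr)
  calc ‖stResolvent t lam g z‖
      ≤ (‖g z‖ + ‖stFactor t lam z‖ * ‖Stop t (fun w => g w / stFactor t lam w) z‖ / ‖lam‖) /
          ‖lam‖ := by
        rw [stResolvent, norm_div]
        gcongr
        refine (norm_add_le _ _).trans_eq ?_
        rw [norm_div, norm_mul]
    _ ≤ (‖g z‖ + stFactorBound t lam * ((1 - t)⁻¹ * (stFactorBound t lam *
          ∫ s in (0 : ℝ)..1, ‖g ((s : ℂ) * z)‖)) / ‖lam‖) / ‖lam‖ := by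
        gcongr
        exact norm_stFactor_le ht0 ht1 lam hz
    _ = _ := by ring

theorem rpow_integral_le_integral_rpow {p : ℝ} (hp : 1 ≤ p) {φ : ℝ → ℝ} (hφ : Continuous φ)
    (h0 : ∀ s, 0 ≤ φ s) : (∫ s in (0 : ℝ)..1, φ s) ^ p ≤ ∫ s in (0 : ℝ)..1, φ s ^ p := by
  have hp0 : 0 ≤ p := by linarith
  have : IsProbabilityMeasure (volume.restrict (Ioc (0 : ℝ) 1)) := ⟨by simp⟩
  have hc : Continuous fun s => φ s ^ p := hφ.rpow_const fun _ => Or.inr hp0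
  rw [intervalIntegral.integral_of_le zero_le_one, intervalIntegral.integral_of_le zero_le_one]
  exact (convexOn_rpow hp).map_integral_le
    (Real.continuous_rpow_const hp0).continuousOn isClosed_Ici
    (Eventually.of_forall h0) (hφ.integrableOn_Ioc) (hc.integrableOn_Ioc)

theorem rpow_linear_combination_le {p A B a b : ℝ} (hp : 1 ≤ p) (hA : 0 ≤ A) (hB : 0 ≤ B)
    (ha : 0 ≤ a) (hb : 0 ≤ b) : (A * a + B * b) ^ p ≤ (A + B) ^ p * (a ^ p + b ^ p) := by
  have hp0 : 0 ≤ p := by linarith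
  calc (A * a + B * b) ^ p ≤ ((A + B) * max a b) ^ p := by
        gcongr
        rw [add_mul]
        gcongr
        · exact le_max_left _ _
        · exact le_max_right _ _
    _ = (A + B) ^ p * max a b ^ p := Real.mul_rpow (by positivity) (by positivity)
    _ ≤ (A + B) ^ p * (a ^ p + b ^ p) := by
        gcongr
        have := Real.rpow_nonneg ha p
        have := Real.rpow_nonneg hb p
        rcases max_choice a b with h | h <;> rw [h] <;> linarith

theorem integral_rpow_linear_combination_le {p A B M L : ℝ} (hp : 1 ≤ p) (hA : 0 ≤ A)
    (hB : 0 ≤ B) (hL : 0 ≤ L) {φ : ℝ → ℝ → ℝ} (hφ : Continuous (Function.uncurry φ))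
    (h0 : ∀ s θ, 0 ≤ φ s θ)
    (hM : ∀ s ∈ Icc (0 : ℝ) 1, ∫ θ in (0 : ℝ)..L, φ s θ ^ p ≤ M) :
    ∫ θ in (0 : ℝ)..L, (A * φ 1 θ + B * ∫ s in (0 : ℝ)..1, φ s θ) ^ p ≤
      (A + B) ^ p * (M + M) := by
  have hp0 : 0 ≤ p := by linarith
  have hφ' : Continuous (Function.uncurry fun θ s => φ s θ) := hφ.comp continuous_swap
  have hφp : Continuous (Function.uncurry fun s θ => φ s θ ^ p) :=
    hφ.rpow_const fun _ => Or.inr hp0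
  have hφp' : Continuous (Function.uncurry fun θ s => φ s θ ^ p) := hφp.comp continuous_swap
  have h1 : Continuous fun θ => φ 1 θ := hφ.comp (by fun_prop : Continuous fun θ => ((1 : ℝ), θ))
  have hI : Continuous fun θ => ∫ s in (0 : ℝ)..1, φ s θ :=
    intervalIntegral.continuous_parametric_intervalIntegral_of_continuous' hφ' 0 1
  have hIp : Continuous fun θ => ∫ s in (0 : ℝ)..1, φ s θ ^ p :=
    intervalIntegral.continuous_parametric_intervalIntegral_of_continuous' hφp' 0 1
  have hJp : Continuous fun s => ∫ θ in (0 : ℝ)..L, φ s θ ^ p :=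
    intervalIntegral.continuous_parametric_intervalIntegral_of_continuous' hφp 0 L
  have h1p : Continuous fun θ => φ 1 θ ^ p := h1.rpow_const fun _ => Or.inr hp0
  have hswap : ∫ θ in (0 : ℝ)..L, ∫ s in (0 : ℝ)..1, φ s θ ^ p =
      ∫ s in (0 : ℝ)..1, ∫ θ in (0 : ℝ)..L, φ s θ ^ p := by
    refine intervalIntegral_intervalIntegral_swap ?_
    rw [uIoc_of_le hL, uIoc_of_le zero_le_one]
    exact (hφp'.continuousOn.integrableOn_compact (isCompact_Icc.prod isCompact_Icc)).mono_set
      (prod_mono Ioc_subset_Icc_self Ioc_subset_Icc_self)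
  calc ∫ θ in (0 : ℝ)..L, (A * φ 1 θ + B * ∫ s in (0 : ℝ)..1, φ s θ) ^ p
      ≤ ∫ θ in (0 : ℝ)..L, (A + B) ^ p * (φ 1 θ ^ p + ∫ s in (0 : ℝ)..1, φ s θ ^ p) := by
        refine intervalIntegral.integral_mono_on hL ?_ ?_ fun θ _ => ?_
        · exact (((h1.const_mul A).add (hI.const_mul B)).rpow_const
            fun _ => Or.inr hp0).intervalIntegrable _ _
        · exact ((h1p.add hIp).const_mul _).intervalIntegrable _ _
        · have hs : Continuous fun s => φ s θ :=
            hφ.comp (by fun_prop : Continuous fun s => (s, θ))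
          refine (rpow_linear_combination_le hp hA hB (h0 1 θ)
            (intervalIntegral.integral_nonneg zero_le_one fun s _ => h0 s θ)).trans ?_
          gcongr
          exact rpow_integral_le_integral_rpow hp hs fun s => h0 s θ
    _ = (A + B) ^ p * ((∫ θ in (0 : ℝ)..L, φ 1 θ ^ p) +
          ∫ s in (0 : ℝ)..1, ∫ θ in (0 : ℝ)..L, φ s θ ^ p) := by
        rw [intervalIntegral.integral_const_mul, intervalIntegral.integral_add
          (h1p.intervalIntegrable _ _) (hIp.intervalIntegrable _ _), hswap]
    _ ≤ (A + B) ^ p * (M + M) := by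
        gcongr
        · exact hM 1 (by simp)
        · calc ∫ s in (0 : ℝ)..1, ∫ θ in (0 : ℝ)..L, φ s θ ^ p ≤ ∫ _ in (0 : ℝ)..1, M :=
                intervalIntegral.integral_mono_on zero_le_one (hJp.intervalIntegrable _ _)
                  (by simp) hM
            _ = M := by simp

theorem integral_rpow_nonneg (p r : ℝ) (f : ℂ → ℂ) :
    0 ≤ ∫ θ in (0 : ℝ)..(2 * Real.pi),
      ‖f ((r : ℂ) * Complex.exp ((θ : ℂ) * Complex.I))‖ ^ p :=
  intervalIntegral.integral_nonneg (by positivity) fun _ _ => by positivity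

theorem Mp_nonneg (p r : ℝ) (f : ℂ → ℂ) : 0 ≤ Mp p r f :=
  Real.rpow_nonneg (mul_nonneg (by positivity) (integral_rpow_nonneg p r f)) _

theorem Mp_le_hardyNorm {p : ℝ} {f : ℂ → ℂ} (hf : MemHp p f) {r : ℝ} (hr : r ∈ Ico (0 : ℝ) 1) :
    Mp p r f ≤ hardyNorm p f :=
  le_csSup hf.2 (mem_image_of_mem _ hr)

theorem hardyNorm_nonneg (p : ℝ) (f : ℂ → ℂ) : 0 ≤ hardyNorm p f :=
  Real.sSup_nonneg (by rintro _ ⟨r, -, rfl⟩; exact Mp_nonneg p r f)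

theorem hardyNorm_le {p K : ℝ} {f : ℂ → ℂ} (h : ∀ r ∈ Ico (0 : ℝ) 1, Mp p r f ≤ K) :
    hardyNorm p f ≤ K :=
  csSup_le ((nonempty_Ico.mpr one_pos).image _) (by rintro _ ⟨r, hr, rfl⟩; exact h r hr)

theorem integral_rpow_le_of_Mp_le {p r K : ℝ} (hp : 1 ≤ p) {f : ℂ → ℂ} (h : Mp p r f ≤ K) :
    ∫ θ in (0 : ℝ)..(2 * Real.pi),
      ‖f ((r : ℂ) * Complex.exp ((θ : ℂ) * Complex.I))‖ ^ p ≤ 2 * Real.pi * K ^ p := by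
  have hp0 : 0 < p := by linarith
  have hI := integral_rpow_nonneg p r f
  have h' := Real.rpow_le_rpow (Mp_nonneg p r f) h hp0.le
  rw [Mp, ← Real.rpow_mul (by positivity), one_div_mul_cancel hp0.ne', Real.rpow_one,
    one_div_mul_eq_div, div_le_iff₀ (by positivity)] at h'
  linarith

theorem Mp_le_of_integral_rpow_le {p r K : ℝ} (hp : 1 ≤ p) (hK : 0 ≤ K) {f : ℂ → ℂ}
    (h : ∫ θ in (0 : ℝ)..(2 * Real.pi),
      ‖f ((r : ℂ) * Complex.exp ((θ : ℂ) * Complex.I))‖ ^ p ≤ 2 * Real.pi * K ^ p) :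
    Mp p r f ≤ K := by
  have hp0 : 0 < p := by linarith
  have hI := integral_rpow_nonneg p r f
  rw [Mp, one_div p, Real.rpow_inv_le_iff_of_pos (by positivity) hK hp0, one_div_mul_eq_div,
    div_le_iff₀ (by positivity)]
  linarith

theorem circle_mem_ball {r : ℝ} (hr : r ∈ Ico (0 : ℝ) 1) (θ : ℝ) :
    (r : ℂ) * Complex.exp ((θ : ℂ) * Complex.I) ∈ ball (0 : ℂ) 1 := by
  rw [mem_ball_zero_iff, norm_mul, Complex.norm_exp_ofReal_mul_I, mul_one,
    Complex.norm_of_nonneg hr.1]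
  exact hr.2

theorem Mp_le_of_norm_le {p A B : ℝ} (hp : 1 ≤ p) (hA : 0 ≤ A) (hB : 0 ≤ B) {F g : ℂ → ℂ}
    (hF : ContinuousOn F (ball (0 : ℂ) 1)) (hg : MemHp p g)
    (h : ∀ z ∈ ball (0 : ℂ) 1, ‖F z‖ ≤ A * ‖g z‖ + B * ∫ s in (0 : ℝ)..1, ‖g ((s : ℂ) * z)‖)
    {r : ℝ} (hr : r ∈ Ico (0 : ℝ) 1) : Mp p r F ≤ 2 * (A + B) * hardyNorm p g := by
  have hp0 : 0 < p := by linarith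
  have hN := hardyNorm_nonneg p g
  set N := hardyNorm p g
  let c : ℝ → ℝ := fun s => projIcc (0 : ℝ) 1 zero_le_one s
  have hcc : Continuous c := continuous_subtype_val.comp continuous_projIcc
  have hc : ∀ s ∈ Icc (0 : ℝ) 1, c s = s := fun s hs => by simp [c, projIcc_of_mem zero_le_one hs]
  have hcm : ∀ s, c s ∈ Icc (0 : ℝ) 1 := fun s => (projIcc (0 : ℝ) 1 zero_le_one s).2
  let φ : ℝ → ℝ → ℝ := fun s θ =>
    ‖g ((c s : ℂ) * ((r : ℂ) * Complex.exp ((θ : ℂ) * Complex.I)))‖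
  have hφ : Continuous (Function.uncurry φ) := by
    refine (hg.1.continuousOn.comp_continuous (f := fun x : ℝ × ℝ =>
      (c x.1 : ℂ) * ((r : ℂ) * Complex.exp ((x.2 : ℂ) * Complex.I))) (by fun_prop)
      fun x => ofReal_mul_mem_ball (hcm _) (circle_mem_ball hr _)).norm
  have hφM : ∀ s ∈ Icc (0 : ℝ) 1,
      ∫ θ in (0 : ℝ)..(2 * Real.pi), φ s θ ^ p ≤ 2 * Real.pi * N ^ p := fun s hs => by
    have hsr : s * r ∈ Ico (0 : ℝ) 1 :=
      ⟨mul_nonneg hs.1 hr.1, (mul_le_of_le_one_left hr.1 hs.2).trans_lt hr.2⟩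
    have := integral_rpow_le_of_Mp_le hp (Mp_le_hardyNorm hg hsr)
    simpa only [φ, hc s hs, ofReal_mul, mul_assoc] using this
  have hmain := integral_rpow_linear_combination_le hp hA hB (by positivity) hφ
    (fun _ _ => norm_nonneg _) hφM
  refine Mp_le_of_integral_rpow_le hp (by positivity) (le_trans ?_ (hmain.trans ?_))
  · have hφ' : Continuous (Function.uncurry fun θ s => φ s θ) := hφ.comp continuous_swap
    have h1 : Continuous fun θ => φ 1 θ := hφ.comp (by fun_prop : Continuous fun θ => ((1 : ℝ), θ))
    have hI : Continuous fun θ => ∫ s in (0 : ℝ)..1, φ s θ :=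
      intervalIntegral.continuous_parametric_intervalIntegral_of_continuous' hφ' 0 1
    have hFc : Continuous fun θ : ℝ => ‖F ((r : ℂ) * Complex.exp ((θ : ℂ) * Complex.I))‖ :=
      (hF.comp_continuous (by fun_prop) (circle_mem_ball hr)).norm
    refine intervalIntegral.integral_mono_on (by positivity)
      ((hFc.rpow_const fun _ => Or.inr hp0.le).intervalIntegrable _ _)
      ((((h1.const_mul A).add (hI.const_mul B)).rpow_const
        fun _ => Or.inr hp0.le).intervalIntegrable _ _) fun θ _ => ?_
    refine Real.rpow_le_rpow (norm_nonneg _) ?_ hp0.le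
    convert h _ (circle_mem_ball hr θ) using 2
    · simp [φ, hc 1 (by simp)]
    · congr 1
      refine intervalIntegral.integral_congr fun s hs => ?_
      rw [uIcc_of_le zero_le_one] at hs
      simp only [φ, hc s hs]
  · have h2 : (2 : ℝ) ≤ 2 ^ p := by
      simpa using Real.rpow_le_rpow_of_exponent_le one_le_two hp
    rw [Real.mul_rpow (by positivity) hN, Real.mul_rpow zero_le_two (by positivity)]
    have : 0 ≤ (A + B) ^ p * (2 * Real.pi * N ^ p) := by positivity
    nlinarith

theorem memHp_of_norm_le {p A B : ℝ} (hp : 1 ≤ p) (hA : 0 ≤ A) (hB : 0 ≤ B) {F g : ℂ → ℂ}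
    (hF : DifferentiableOn ℂ F (ball (0 : ℂ) 1)) (hg : MemHp p g)
    (h : ∀ z ∈ ball (0 : ℂ) 1, ‖F z‖ ≤ A * ‖g z‖ + B * ∫ s in (0 : ℝ)..1, ‖g ((s : ℂ) * z)‖) :
    MemHp p F :=
  ⟨hF, 2 * (A + B) * hardyNorm p g, by
    rintro _ ⟨r, hr, rfl⟩
    exact Mp_le_of_norm_le hp hA hB hF.continuousOn hg h hr⟩

theorem Mp_const {p : ℝ} (hp : 1 ≤ p) (r : ℝ) (c : ℂ) : Mp p r (fun _ => c) = ‖c‖ := by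
  have hp0 : 0 < p := by linarith
  rw [Mp, intervalIntegral.integral_const, smul_eq_mul, sub_zero, ← mul_assoc,
    one_div_mul_cancel (by positivity), one_mul, one_div, Real.rpow_rpow_inv (norm_nonneg c) hp0.ne']

theorem Mp_at_zero {p : ℝ} (hp : 1 ≤ p) (f : ℂ → ℂ) : Mp p 0 f = ‖f 0‖ := by
  rw [← Mp_const hp 0 (f 0)]
  simp [Mp]

theorem memHp_const {p : ℝ} (hp : 1 ≤ p) (c : ℂ) : MemHp p (fun _ => c) :=
  ⟨differentiableOn_const c, ‖c‖, by rintro _ ⟨r, -, rfl⟩; exact (Mp_const hp r c).le⟩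

theorem memHp_smul_sub_Stop {p t : ℝ} (hp : 1 ≤ p) (ht0 : 0 ≤ t) (ht1 : t < 1) (lam : ℂ)
    {f : ℂ → ℂ} (hf : MemHp p f) : MemHp p (fun z => lam * f z - Stop t f z) := by
  have ht : 0 < 1 - t := by linarith
  refine memHp_of_norm_le hp (norm_nonneg lam) (inv_pos.mpr ht).le
    ((hf.1.const_mul lam).sub (differentiableOn_Stop ht0 ht1 hf.1)) hf fun z hz => ?_
  refine (norm_sub_le _ _).trans ?_
  rw [norm_mul]
  gcongr
  exact norm_Stop_le ht0 ht1 hf.1 hz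

theorem MemHp.sub {p : ℝ} (hp : 1 ≤ p) {f g : ℂ → ℂ} (hf : MemHp p f) (hg : MemHp p g) :
    MemHp p (fun z => f z - g z) := by
  have hp0 : 0 < p := by linarith
  have hfN := hardyNorm_nonneg p f
  have hgN := hardyNorm_nonneg p g
  set N := hardyNorm p f + hardyNorm p g with hN
  refine ⟨hf.1.sub hg.1, 4 * N, ?_⟩
  rintro _ ⟨r, hr, rfl⟩
  have hcont {u : ℂ → ℂ} (hu : DifferentiableOn ℂ u (ball (0 : ℂ) 1)) :
      Continuous fun θ : ℝ => ‖u ((r : ℂ) * Complex.exp ((θ : ℂ) * Complex.I))‖ ^ p :=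
    (hu.continuousOn.comp_continuous (by fun_prop) (circle_mem_ball hr)).norm.rpow_const
      fun _ => Or.inr hp0.le
  have hfI := integral_rpow_le_of_Mp_le hp ((Mp_le_hardyNorm hf hr).trans (by linarith : _ ≤ N))
  have hgI := integral_rpow_le_of_Mp_le hp ((Mp_le_hardyNorm hg hr).trans (by linarith : _ ≤ N))
  have h2 : (2 : ℝ) ≤ 2 ^ p := by
    simpa using Real.rpow_le_rpow_of_exponent_le one_le_two hp
  refine Mp_le_of_integral_rpow_le hp (by positivity) ?_
  calc _ ≤ ∫ θ in (0 : ℝ)..(2 * Real.pi), (2 : ℝ) ^ p *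
          (‖f ((r : ℂ) * Complex.exp ((θ : ℂ) * Complex.I))‖ ^ p +
            ‖g ((r : ℂ) * Complex.exp ((θ : ℂ) * Complex.I))‖ ^ p) := by
        refine intervalIntegral.integral_mono_on (by positivity)
          ((hcont (hf.1.sub hg.1)).intervalIntegrable _ _)
          ((((hcont hf.1).add (hcont hg.1)).const_mul _).intervalIntegrable _ _) fun θ _ => ?_
        refine (Real.rpow_le_rpow (norm_nonneg _) (norm_sub_le _ _) hp0.le).trans ?_
        simpa [one_add_one_eq_two] using rpow_linear_combination_le hp zero_le_one zero_le_one
          (norm_nonneg (f ((r : ℂ) * Complex.exp ((θ : ℂ) * Complex.I))))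
          (norm_nonneg (g ((r : ℂ) * Complex.exp ((θ : ℂ) * Complex.I))))
    _ ≤ 2 ^ p * (2 * Real.pi * N ^ p + 2 * Real.pi * N ^ p) := by
        rw [intervalIntegral.integral_const_mul, intervalIntegral.integral_add
          ((hcont hf.1).intervalIntegrable _ _) ((hcont hg.1).intervalIntegrable _ _)]
        gcongr
    _ ≤ 2 * Real.pi * (4 * N) ^ p := by
        rw [show (4 : ℝ) * N = 2 * (2 * N) by ring, Real.mul_rpow zero_le_two (by positivity),
          Real.mul_rpow zero_le_two (by positivity)]
        have : 0 ≤ 2 ^ p * (2 * Real.pi * N ^ p) := by positivity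
        nlinarith

theorem stInjAt {p t : ℝ} (ht0 : 0 ≤ t) (ht1 : t < 1) (lam : ℂ) : StInjAt p t lam := by
  intro f hf h z hz
  by_cases hlam : lam = 0
  · have hS : EqOn (Stop t f) 0 (ball (0 : ℂ) 1) := fun w hw => by simpa [hlam] using h hw
    have hd := (hasDerivAt_Stop ht0 ht1 hf.1 hz).unique
      ((hasDerivAt_const z (0 : ℂ)).congr_of_eventuallyEq
        (hS.eventuallyEq_of_mem (isOpen_ball.mem_nhds hz)))
    exact (div_eq_zero_iff.mp hd).resolve_right (one_sub_mul_ne_zero ht0 ht1 hz)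
  · have hle := norm_stResolvent_le (g := fun z => lam * f z - Stop t f z) ht0 ht1 lam
      ((hf.1.const_mul lam).sub (differentiableOn_Stop ht0 ht1 hf.1)) hz
    have hint : ∫ s in (0 : ℝ)..1,
        ‖lam * f ((s : ℂ) * z) - Stop t f ((s : ℂ) * z)‖ = ∫ _ in (0 : ℝ)..1, (0 : ℝ) := by
      refine intervalIntegral.integral_congr fun s hs => ?_
      rw [uIcc_of_le zero_le_one] at hs
      simpa using h (ofReal_mul_mem_ball hs hz)
    have hz0 : lam * f z - Stop t f z = 0 := h hz
    have heq := stResolvent_left_inverse ht0 ht1 hlam hf.1 hz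
    rw [hint, hz0] at hle
    rw [heq]
    simpa using hle

theorem memHp_stResolvent {p t : ℝ} (hp : 1 ≤ p) (ht0 : 0 ≤ t) (ht1 : t < 1) {lam : ℂ}
    (hlam : lam ≠ 0) {g : ℂ → ℂ} (hg : MemHp p g) : MemHp p (stResolvent t lam g) := by
  have ht : 0 < 1 - t := by linarith
  exact memHp_of_norm_le hp (by positivity) (by positivity)
    (differentiableOn_stResolvent ht0 ht1 hlam hg.1) hg
    fun z hz => norm_stResolvent_le ht0 ht1 lam hg.1 hz

theorem stSurjAt {p t : ℝ} (hp : 1 ≤ p) (ht0 : 0 ≤ t) (ht1 : t < 1) {lam : ℂ}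
    (hlam : lam ≠ 0) : StSurjAt p t lam := fun _ hg =>
  ⟨_, memHp_stResolvent hp ht0 ht1 hlam hg, stResolvent_right_inverse ht0 ht1 hlam hg.1⟩

theorem stDenseRanAt_of_stSurjAt {p t : ℝ} (hp : 1 ≤ p) {lam : ℂ} (h : StSurjAt p t lam) :
    StDenseRanAt p t lam := by
  intro g hg ε hε
  obtain ⟨f, hf, hfg⟩ := h g hg
  refine ⟨f, hf, (hardyNorm_le fun r hr => ?_).trans_lt hε⟩
  have hp0 : 0 < p := by linarith
  refine Mp_le_of_integral_rpow_le hp le_rfl (le_of_eq ?_)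
  rw [Real.zero_rpow hp0.ne', mul_zero]
  refine (intervalIntegral.integral_congr fun θ _ => ?_).trans intervalIntegral.integral_zero
  have := hfg (circle_mem_ball hr θ)
  simp only at this
  simp only [this, sub_self, norm_zero, Real.zero_rpow hp0.ne']

theorem not_stDenseRanAt_zero {p t : ℝ} (hp : 1 ≤ p) (ht0 : 0 ≤ t) (ht1 : t < 1) :
    ¬ StDenseRanAt p t 0 := by
  intro h
  obtain ⟨f, hf, hlt⟩ := h _ (memHp_const hp 1) 1 one_pos
  have hle := Mp_le_hardyNorm ((memHp_smul_sub_Stop hp ht0 ht1 0 hf).sub hp (memHp_const hp 1))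
    (left_mem_Ico.mpr one_pos)
  rw [Mp_at_zero hp] at hle
  simp only [Stop_zero, zero_mul, sub_zero, zero_sub, norm_neg, norm_one] at hle hlt
  linarith

theorem isResolventPt_of_ne_zero {p t : ℝ} (hp : 1 ≤ p) (ht0 : 0 ≤ t) (ht1 : t < 1) {lam : ℂ}
    (hlam : lam ≠ 0) : IsResolventPt (MemHp p) (hardyNorm p) (Stop t) lam := by
  have ht : 0 < 1 - t := by linarith
  refine ⟨fun f hf => memHp_smul_sub_Stop hp ht0 ht1 lam hf, stSurjAt hp ht0 ht1 hlam,
    2 * (‖lam‖⁻¹ + stFactorBound t lam ^ 2 * (1 - t)⁻¹ * ‖lam‖⁻¹ ^ 2), fun f hf => ?_⟩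
  have hg := memHp_smul_sub_Stop hp ht0 ht1 lam hf
  refine hardyNorm_le fun r hr => Mp_le_of_norm_le hp (by positivity) (by positivity)
    hf.1.continuousOn hg (fun z hz => ?_) hr
  exact (congrArg norm (stResolvent_left_inverse ht0 ht1 hlam hf.1 hz)).trans_le
    (norm_stResolvent_le ht0 ht1 lam hg.1 hz)

/-- For `1 ≤ p < ∞` and `t ∈ [0,1)`, the operator `S_t = S ∘ C_t` on `H^p` has empty
point spectrum, residual spectrum equal to `{0}`, empty continuous spectrum and hence
spectrum exactly `{0}`. -/
theorem St_spectrum_Hp (p t : ℝ) (hp : 1 ≤ p) (ht0 : 0 ≤ t) (ht1 : t < 1) (lam : ℂ) :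
    (¬ ∃ f, MemHp p f ∧ (∃ z ∈ Metric.ball (0:ℂ) 1, f z ≠ 0) ∧
        Set.EqOn (Stop t f) (fun z => lam * f z) (Metric.ball (0:ℂ) 1)) ∧
    ((StInjAt p t lam ∧ ¬ StDenseRanAt p t lam) ↔ lam = 0) ∧
    (¬ (StInjAt p t lam ∧ StDenseRanAt p t lam ∧ ¬ StSurjAt p t lam)) ∧
    ((¬ IsResolventPt (MemHp p) (hardyNorm p) (Stop t) lam) ↔ lam = 0) := by
  have hne : lam ≠ 0 → StDenseRanAt p t lam := fun h =>
    stDenseRanAt_of_stSurjAt hp (stSurjAt hp ht0 ht1 h)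
  refine ⟨?_, ⟨fun h => by_contra fun hlam => h.2 (hne hlam), ?_⟩, ?_,
    ⟨fun h => by_contra fun hlam => h (isResolventPt_of_ne_zero hp ht0 ht1 hlam), ?_⟩⟩
  · rintro ⟨f, hf, ⟨z, hz, hfz⟩, heq⟩
    exact hfz (stInjAt ht0 ht1 lam f hf (fun w hw => by simp [heq hw]) hz)
  · rintro rfl
    exact ⟨stInjAt ht0 ht1 0, not_stDenseRanAt_zero hp ht0 ht1⟩
  · rintro ⟨-, hd, hs⟩
    refine hs (stSurjAt hp ht0 ht1 ?_)
    rintro rfl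
    exact not_stDenseRanAt_zero hp ht0 ht1 hd
  · rintro rfl h
    exact not_stDenseRanAt_zero hp ht0 ht1 (stDenseRanAt_of_stSurjAt hp h.2.1)
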